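/- (Theorem 1, Variant 1: recursive feasibility, constraint satisfaction and convergence of rollout ETC with cyclic prediction horizon.) Consider the networked control system with token bucket traffic specification and rollout ETC in Variant 1: terminal set Ξ_f(k) = S := Z₀ × (ℤ ∩ [c−g, b]) where Z₀ ⊆ 𝕏 × 𝕌 is a closed set containing the origin satisfying A₀^j A₁ Z₀ ⊆ 𝕏 × 𝕌 for j = 0, …, M−2, A₀^{M−1} A₁ Z₀ ⊆ Z₀ and K Z₀ ⊆ 𝕌; terminal cost V_f(ξ, k) = [x; u]ᵀ P₀ [x; u] with symmetric positive semidefinite P₀ satisfying A₁ᵀ(A₀^{M−1})ᵀ P₀ A₀^{M−1} A₁ − P₀ + diag(Q, 0) + Kᵀ R K + Σ_{j=1}^{M−1} A₁ᵀ(A₀^{j−1})ᵀ diag(Q, R) A₀^{j−1} A₁ ⪯ 0; and prediction horizon N(k) = N̄ − (k mod M) with N̄ ≥ M. If the optimal control problem P(ξ(0), 0) is feasible, then along every closed-loop trajectory ξ(k+1) = f(ξ(k), π(k)) in which each π(k) is the first element of a minimizer of P(ξ(k), k): (i) P(ξ(k), k) is feasible for every k ∈ ℕ; (ii) ξ(k)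 ∈ Ξ and π(k) ∈ Π for every k, i.e., the plant state and input constraints and the token bucket traffic specification are fulfilled; and (iii) (x(k), u(k)) → (0, 0) as k → ∞. -/

import Mathlib

open Matrix

/-- Overall state of the networked control system: plant state `x`,
held input `u`, and integer bucket level `β`. -/
abbrev NCSState (n m : ℕ) := (Fin n → ℝ) × (Fin m → ℝ) × ℤ

/-- Overall input: control update `v` and transmission decision `γ ∈ {0,1}`
(modelled as a `Bool`). -/
abbrev NCSInput (n m : ℕ) := (Fin m → ℝ) × Bool

/-- Overall dynamics
`f(ξ, π) = (Ax + Bγv + B(1-γ)u, γv + (1-γ)u, min (β + g - γc) b)`. -/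
noncomputable def ncsDyn {n m : ℕ} (A : Matrix (Fin n) (Fin n) ℝ)
    (B : Matrix (Fin n) (Fin m) ℝ) (g c b : ℕ)
    (ξ : NCSState n m) (π : NCSInput n m) : NCSState n m :=
  ⟨A.mulVec ξ.1 + B.mulVec (if π.2 then π.1 else ξ.2.1),
   if π.2 then π.1 else ξ.2.1,
   min (ξ.2.2 + (g : ℤ) - if π.2 then (c : ℤ) else 0) (b : ℤ)⟩

/-- The stacked vector `z = [x; u] ∈ ℝ^{n+m}`. -/
def vcat {n m : ℕ} (x : Fin n → ℝ) (u : Fin m → ℝ) : Fin n ⊕ Fin m → ℝ :=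
  Sum.elim x u

/-- No-transmission step matrix `A₀ = [[A, B], [0, I]]`. -/
noncomputable def A0mat {n m : ℕ} (A : Matrix (Fin n) (Fin n) ℝ)
    (B : Matrix (Fin n) (Fin m) ℝ) :
    Matrix (Fin n ⊕ Fin m) (Fin n ⊕ Fin m) ℝ :=
  fromBlocks A B 0 1

/-- Transmission step matrix `A₁ = [[A, 0], [0, 0]] + [[B], [I]] K`. -/
noncomputable def A1mat {n m : ℕ} (A : Matrix (Fin n) (Fin n) ℝ)
    (B : Matrix (Fin n) (Fin m) ℝ) (K : Matrix (Fin m) (Fin n ⊕ Fin m) ℝ) :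
    Matrix (Fin n ⊕ Fin m) (Fin n ⊕ Fin m) ℝ :=
  fromBlocks A 0 0 0 + fromRows B (1 : Matrix (Fin m) (Fin m) ℝ) * K

/-- The trajectory of the overall system generated from initial state `ξ0`
by the input sequence `πs`. -/
noncomputable def ncsTraj {n m : ℕ} (A : Matrix (Fin n) (Fin n) ℝ)
    (B : Matrix (Fin n) (Fin m) ℝ) (g c b : ℕ)
    (ξ0 : NCSState n m) (πs : ℕ → NCSInput n m) : ℕ → NCSState n m
  | 0 => ξ0
  | k + 1 => ncsDyn A B g c b (ncsTraj A B g c b ξ0 πs k) (πs k)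

/-- Stage cost `ℓ(ξ, π) = xᵀQx + (1-γ)uᵀRu + γvᵀRv`. -/
noncomputable def stageCost {n m : ℕ} (Q : Matrix (Fin n) (Fin n) ℝ)
    (R : Matrix (Fin m) (Fin m) ℝ) (ξ : NCSState n m) (π : NCSInput n m) : ℝ :=
  ξ.1 ⬝ᵥ Q.mulVec ξ.1 +
    (if π.2 then π.1 ⬝ᵥ R.mulVec π.1 else ξ.2.1 ⬝ᵥ R.mulVec ξ.2.1)

/-- Feasibility for the constrained OCP: state constraints
`ξ(i) ∈ Ξ = 𝕏 × 𝕌 × (ℤ ∩ [0, b])` and input constraints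
`π(i) ∈ Π = 𝕌 × {0,1}` for `i = 0, …, N-1`, and terminal constraint
`ξ(N) ∈ Ξf`. -/
noncomputable def FeasOCP {n m : ℕ} (A : Matrix (Fin n) (Fin n) ℝ)
    (B : Matrix (Fin n) (Fin m) ℝ) (g c b : ℕ)
    (𝕏 : Set (Fin n → ℝ)) (𝕌 : Set (Fin m → ℝ))
    (ξ0 : NCSState n m) (N : ℕ) (Ξf : Set (NCSState n m))
    (πs : ℕ → NCSInput n m) : Prop :=
  (∀ i < N, (ncsTraj A B g c b ξ0 πs i).1 ∈ 𝕏 ∧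
      (ncsTraj A B g c b ξ0 πs i).2.1 ∈ 𝕌 ∧
      0 ≤ (ncsTraj A B g c b ξ0 πs i).2.2 ∧
      (ncsTraj A B g c b ξ0 πs i).2.2 ≤ (b : ℤ) ∧
      (πs i).1 ∈ 𝕌) ∧
  ncsTraj A B g c b ξ0 πs N ∈ Ξf

/-- Cost of the OCP with horizon `N` and terminal cost `Vf`:
`Σ_{i<N} ℓ(ξ(i), π(i)) + Vf(ξ(N))`. -/
noncomputable def costGen {n m : ℕ} (A : Matrix (Fin n) (Fin n) ℝ)
    (B : Matrix (Fin n) (Fin m) ℝ) (g c b : ℕ)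
    (Q : Matrix (Fin n) (Fin n) ℝ) (R : Matrix (Fin m) (Fin m) ℝ)
    (Vf : NCSState n m → ℝ)
    (ξ0 : NCSState n m) (N : ℕ) (πs : ℕ → NCSInput n m) : ℝ :=
  ∑ i ∈ Finset.range N, stageCost Q R (ncsTraj A B g c b ξ0 πs i) (πs i) +
    Vf (ncsTraj A B g c b ξ0 πs N)

section helpers

variable {n m : ℕ} (A : Matrix (Fin n) (Fin n) ℝ) (B : Matrix (Fin n) (Fin m) ℝ) (g c b : ℕ)

theorem traj_shift (ξ : NCSState n m) (πs : ℕ → NCSInput n m) (i : ℕ) :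
    ncsTraj A B g c b (ncsDyn A B g c b ξ (πs 0)) (fun i => πs (i + 1)) i =
      ncsTraj A B g c b ξ πs (i + 1) := by
  induction i with
  | zero => rfl
  | succ k ih =>
    rw [ncsTraj, ih, ← ncsTraj]

theorem traj_congr (ξ : NCSState n m) (πs πs' : ℕ → NCSInput n m) (k : ℕ)
    (h : ∀ i < k, πs i = πs' i) :
    ncsTraj A B g c b ξ πs k = ncsTraj A B g c b ξ πs' k := by
  induction k with
  | zero => rfl
  | succ k ih =>
    rw [ncsTraj, ncsTraj, ih (fun i hi => h i (by omega)), h k (by omega)]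

theorem traj_append (ξ : NCSState n m) (πs : ℕ → NCSInput n m) (N i : ℕ) :
    ncsTraj A B g c b ξ πs (N + i) =
      ncsTraj A B g c b (ncsTraj A B g c b ξ πs N) (fun i => πs (N + i)) i := by
  induction i with
  | zero => rfl
  | succ k ih =>
    rw [← Nat.add_assoc, ncsTraj, ih, ← ncsTraj]

theorem feas_shift (𝕏 : Set (Fin n → ℝ)) (𝕌 : Set (Fin m → ℝ)) (ξ : NCSState n m) (N : ℕ)
    (Ξf : Set (NCSState n m)) (πs : ℕ → NCSInput n m)
    (h : FeasOCP A B g c b 𝕏 𝕌 ξ (N + 1) Ξf πs) :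
    FeasOCP A B g c b 𝕏 𝕌 (ncsDyn A B g c b ξ (πs 0)) N Ξf (fun i => πs (i + 1)) := by
  refine ⟨fun i hi => ?_, ?_⟩
  · rw [traj_shift]
    exact h.1 (i + 1) (by omega)
  · rw [traj_shift]
    exact h.2

theorem cost_shift (Q : Matrix (Fin n) (Fin n) ℝ) (R : Matrix (Fin m) (Fin m) ℝ)
    (Vf : NCSState n m → ℝ) (ξ : NCSState n m) (N : ℕ) (πs : ℕ → NCSInput n m) :
    costGen A B g c b Q R Vf ξ (N + 1) πs = stageCost Q R ξ (πs 0) +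
      costGen A B g c b Q R Vf (ncsDyn A B g c b ξ (πs 0)) N (fun i => πs (i + 1)) := by
  unfold costGen
  rw [Finset.sum_range_succ']
  simp only [traj_shift]
  simp only [ncsTraj]
  ring

def concatSeq (N : ℕ) (πs σ : ℕ → NCSInput n m) : ℕ → NCSInput n m :=
  fun i => if i < N then πs i else σ (i - N)

theorem traj_concat_lt (ξ : NCSState n m) (πs σ : ℕ → NCSInput n m) (N i : ℕ) (hi : i ≤ N) :
    ncsTraj A B g c b ξ (concatSeq N πs σ) i = ncsTraj A B g c b ξ πs i := by
  apply traj_congr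
  intro j hj
  simp [concatSeq, show j < N by omega]

theorem traj_concat_ge (ξ : NCSState n m) (πs σ : ℕ → NCSInput n m) (N i : ℕ) :
    ncsTraj A B g c b ξ (concatSeq N πs σ) (N + i) =
      ncsTraj A B g c b (ncsTraj A B g c b ξ πs N) σ i := by
  rw [traj_append, traj_concat_lt _ _ _ _ _ _ _ _ _ _ le_rfl]
  congr 1
  funext j
  simp [concatSeq]

theorem feas_concat (𝕏 : Set (Fin n → ℝ)) (𝕌 : Set (Fin m → ℝ)) (ξ : NCSState n m) (N M : ℕ)
    (Ξf Ξf' : Set (NCSState n m)) (πs σ : ℕ → NCSInput n m)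
    (h : FeasOCP A B g c b 𝕏 𝕌 ξ N Ξf πs)
    (h' : FeasOCP A B g c b 𝕏 𝕌 (ncsTraj A B g c b ξ πs N) M Ξf' σ) :
    FeasOCP A B g c b 𝕏 𝕌 ξ (N + M) Ξf' (concatSeq N πs σ) := by
  refine ⟨fun i hi => ?_, ?_⟩
  · by_cases hN : i < N
    · rw [traj_concat_lt _ _ _ _ _ _ _ _ _ _ hN.le]
      simpa [concatSeq, hN] using h.1 i hN
    · obtain ⟨j, rfl⟩ := Nat.exists_eq_add_of_le (not_lt.mp hN)
      rw [traj_concat_ge]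
      simpa [concatSeq] using h'.1 j (by omega)
  · rw [traj_concat_ge]
    exact h'.2

theorem cost_concat (Q : Matrix (Fin n) (Fin n) ℝ) (R : Matrix (Fin m) (Fin m) ℝ)
    (Vf : NCSState n m → ℝ) (ξ : NCSState n m) (N M : ℕ) (πs σ : ℕ → NCSInput n m)
    (h : costGen A B g c b Q R Vf (ncsTraj A B g c b ξ πs N) M σ ≤
      Vf (ncsTraj A B g c b ξ πs N)) :
    costGen A B g c b Q R Vf ξ (N + M) (concatSeq N πs σ) ≤
      costGen A B g c b Q R Vf ξ N πs := by
  unfold costGen at *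
  rw [Finset.sum_range_add]
  simp only [traj_concat_ge]
  have e1 : ∑ i ∈ Finset.range N, stageCost Q R
      (ncsTraj A B g c b ξ (concatSeq N πs σ) i) (concatSeq N πs σ i) =
      ∑ i ∈ Finset.range N, stageCost Q R (ncsTraj A B g c b ξ πs i) (πs i) := by
    apply Finset.sum_congr rfl
    intro i hi
    have hi := Finset.mem_range.mp hi
    rw [traj_concat_lt _ _ _ _ _ _ _ _ _ _ hi.le]
    simp [concatSeq, hi]
  have e2 : ∀ i, concatSeq N πs σ (N + i) = σ i := by
    intro i; simp [concatSeq]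
  simp only [e2]
  rw [e1]
  linarith

/-- local feedback sequence -/
noncomputable def locSeq (K : Matrix (Fin m) (Fin n ⊕ Fin m) ℝ) (z : Fin n ⊕ Fin m → ℝ) :
    ℕ → NCSInput n m :=
  fun i => if i = 0 then (K.mulVec z, true) else (0, false)

theorem vcat_inl_inr (z : Fin n ⊕ Fin m → ℝ) :
    vcat (fun i => z (Sum.inl i)) (fun i => z (Sum.inr i)) = z := by
  funext i; cases i <;> rfl

theorem A0_vcat (x : Fin n → ℝ) (u : Fin m → ℝ) :
    (A0mat A B).mulVec (vcat x u) = vcat (A.mulVec x + B.mulVec u) u := by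
  simp [A0mat, vcat, fromBlocks_mulVec]

theorem A1_vcat (K : Matrix (Fin m) (Fin n ⊕ Fin m) ℝ) (x : Fin n → ℝ) (u : Fin m → ℝ) :
    (A1mat A B K).mulVec (vcat x u) =
      vcat (A.mulVec x + B.mulVec (K.mulVec (vcat x u))) (K.mulVec (vcat x u)) := by
  simp only [A1mat, add_mulVec, ← mulVec_mulVec, fromRows_mulVec]
  generalize K.mulVec (vcat x u) = w
  simp only [vcat, fromBlocks_mulVec]
  funext i; cases i <;> simp

theorem loc_vcat (K : Matrix (Fin m) (Fin n ⊕ Fin m) ℝ) (ξ : NCSState n m) (j : ℕ) :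
    vcat (ncsTraj A B g c b ξ (locSeq K (vcat ξ.1 ξ.2.1)) (j + 1)).1
      (ncsTraj A B g c b ξ (locSeq K (vcat ξ.1 ξ.2.1)) (j + 1)).2.1 =
    ((A0mat A B) ^ j * A1mat A B K).mulVec (vcat ξ.1 ξ.2.1) := by
  induction j with
  | zero => simp [ncsTraj, ncsDyn, locSeq, A1_vcat]
  | succ j ih =>
    rw [ncsTraj, pow_succ', Matrix.mul_assoc, ← mulVec_mulVec, ← ih, A0_vcat]
    simp [ncsDyn, locSeq]

theorem loc_bucket (hgc : g ≤ c) (K : Matrix (Fin m) (Fin n ⊕ Fin m) ℝ) (ξ : NCSState n m)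
    (hβ : (c : ℤ) - (g : ℤ) ≤ ξ.2.2) (j : ℕ) :
    min ((j : ℤ) * g) b ≤
      (ncsTraj A B g c b ξ (locSeq K (vcat ξ.1 ξ.2.1)) (j + 1)).2.2 ∧
    (ncsTraj A B g c b ξ (locSeq K (vcat ξ.1 ξ.2.1)) (j + 1)).2.2 ≤ b := by
  induction j with
  | zero =>
    simp only [ncsTraj, ncsDyn, locSeq]
    simp
    omega
  | succ j ih =>
    rw [ncsTraj]
    generalize ncsTraj A B g c b ξ (locSeq K (vcat ξ.1 ξ.2.1)) (j + 1) = η at *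
    simp only [ncsDyn, locSeq]
    simp
    have : ((j : ℤ) + 1) * g = j * g + g := by ring
    rw [this]
    generalize (j : ℤ) * g = t at *
    omega

theorem quad_conj {ι κ : Type*} [Fintype ι] [Fintype κ] (S : Matrix κ κ ℝ) (T : Matrix κ ι ℝ)
    (z : ι → ℝ) :
    z ⬝ᵥ (Tᵀ * S * T).mulVec z = T.mulVec z ⬝ᵥ S.mulVec (T.mulVec z) := by
  rw [Matrix.mul_assoc, ← mulVec_mulVec, dotProduct_mulVec, vecMul_transpose, mulVec_mulVec]

theorem quad_blocks (Q : Matrix (Fin n) (Fin n) ℝ) (R : Matrix (Fin m) (Fin m) ℝ)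
    (x : Fin n → ℝ) (u : Fin m → ℝ) :
    vcat x u ⬝ᵥ (fromBlocks Q 0 0 R).mulVec (vcat x u) =
      x ⬝ᵥ Q.mulVec x + u ⬝ᵥ R.mulVec u := by
  simp [vcat, fromBlocks_mulVec, dotProduct]

theorem loc_cost (K : Matrix (Fin m) (Fin n ⊕ Fin m) ℝ)
    (Q : Matrix (Fin n) (Fin n) ℝ) (R : Matrix (Fin m) (Fin m) ℝ)
    (P₀ : Matrix (Fin n ⊕ Fin m) (Fin n ⊕ Fin m) ℝ) (L : ℕ)
    (hMI : (-((A1mat A B K)ᵀ * ((A0mat A B) ^ L)ᵀ * P₀ * (A0mat A B) ^ L *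
            A1mat A B K
          - P₀ + fromBlocks Q 0 0 0 + Kᵀ * R * K
          + ∑ j ∈ Finset.Icc 1 L,
              (A1mat A B K)ᵀ * ((A0mat A B) ^ (j - 1))ᵀ * fromBlocks Q 0 0 R *
                (A0mat A B) ^ (j - 1) * A1mat A B K)).PosSemidef)
    (ξ : NCSState n m) :
    costGen A B g c b Q R (fun ξ => vcat ξ.1 ξ.2.1 ⬝ᵥ P₀.mulVec (vcat ξ.1 ξ.2.1)) ξ (L + 1)
      (locSeq K (vcat ξ.1 ξ.2.1)) ≤ vcat ξ.1 ξ.2.1 ⬝ᵥ P₀.mulVec (vcat ξ.1 ξ.2.1) := by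
  have h := hMI.dotProduct_mulVec_nonneg (vcat ξ.1 ξ.2.1)
  have conj : ∀ (S : Matrix (Fin n ⊕ Fin m) (Fin n ⊕ Fin m) ℝ) (j : ℕ),
      vcat ξ.1 ξ.2.1 ⬝ᵥ ((A1mat A B K)ᵀ * ((A0mat A B) ^ j)ᵀ * S * (A0mat A B) ^ j *
        A1mat A B K).mulVec (vcat ξ.1 ξ.2.1) =
      vcat (ncsTraj A B g c b ξ (locSeq K (vcat ξ.1 ξ.2.1)) (j + 1)).1
        (ncsTraj A B g c b ξ (locSeq K (vcat ξ.1 ξ.2.1)) (j + 1)).2.1 ⬝ᵥ S.mulVec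
      (vcat (ncsTraj A B g c b ξ (locSeq K (vcat ξ.1 ξ.2.1)) (j + 1)).1
        (ncsTraj A B g c b ξ (locSeq K (vcat ξ.1 ξ.2.1)) (j + 1)).2.1) := by
    intro S j
    rw [loc_vcat, ← quad_conj, transpose_mul]
    simp only [Matrix.mul_assoc]
  have hsum : ∑ j ∈ Finset.Icc 1 L,
      (A1mat A B K)ᵀ * ((A0mat A B) ^ (j - 1))ᵀ * fromBlocks Q 0 0 R *
                (A0mat A B) ^ (j - 1) * A1mat A B K =
      ∑ j ∈ Finset.range L, (A1mat A B K)ᵀ * ((A0mat A B) ^ j)ᵀ * fromBlocks Q 0 0 R *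
                (A0mat A B) ^ j * A1mat A B K := by
    rw [Finset.range_eq_Ico, ← Finset.Ico_add_one_right_eq_Icc, Finset.sum_Ico_eq_sum_range]
    simp
  rw [hsum] at h
  simp only [star_trivial, neg_mulVec, add_mulVec, sub_mulVec, dotProduct_neg, dotProduct_add,
    dotProduct_sub, Matrix.sum_mulVec, dotProduct_sum, conj, quad_conj, quad_blocks] at h
  unfold costGen
  rw [Finset.sum_range_succ']
  have e0 : stageCost Q R (ncsTraj A B g c b ξ (locSeq K (vcat ξ.1 ξ.2.1)) 0)
      (locSeq K (vcat ξ.1 ξ.2.1) 0) = ξ.1 ⬝ᵥ Q.mulVec ξ.1 +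
       K.mulVec (vcat ξ.1 ξ.2.1) ⬝ᵥ R.mulVec (K.mulVec (vcat ξ.1 ξ.2.1)) := by
    simp [ncsTraj, stageCost, locSeq]
  have e1 : ∀ j η, stageCost Q R η (locSeq K (vcat ξ.1 ξ.2.1) (j + 1)) =
      η.1 ⬝ᵥ Q.mulVec η.1 + η.2.1 ⬝ᵥ R.mulVec η.2.1 := by
    intro j η
    simp [stageCost, locSeq]
  rw [e0]
  simp only [e1]
  simp only [zero_mulVec, dotProduct_zero] at h
  linarith

theorem posDef_tendsto {d : ℕ} (Q : Matrix (Fin d) (Fin d) ℝ) (hQ : Q.PosDef)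
    (x : ℕ → Fin d → ℝ)
    (h : Filter.Tendsto (fun k => x k ⬝ᵥ Q.mulVec (x k)) Filter.atTop (nhds 0)) :
    Filter.Tendsto x Filter.atTop (nhds 0) := by
  have hc : Continuous (fun y : Fin d → ℝ => y ⬝ᵥ Q.mulVec y) := by fun_prop
  have key : ∃ ε > 0, ∀ y : Fin d → ℝ, ε * ‖y‖ ^ 2 ≤ y ⬝ᵥ Q.mulVec y := by
    rcases (Metric.sphere (0 : Fin d → ℝ) 1).eq_empty_or_nonempty with he | hne
    · refine ⟨1, one_pos, fun y => ?_⟩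
      have : y = 0 := by
        by_contra hy
        have : ‖y‖⁻¹ • y ∈ Metric.sphere (0 : Fin d → ℝ) 1 := by
          simp [norm_smul, hy]
        simp [he] at this
      simp [this]
    · obtain ⟨w, hw, hmin⟩ := (isCompact_sphere (0 : Fin d → ℝ) 1).exists_isMinOn hne hc.continuousOn
      have hw0 : w ≠ 0 := by
        rintro rfl
        simp at hw
      refine ⟨w ⬝ᵥ Q.mulVec w, by simpa using hQ.dotProduct_mulVec_pos hw0, fun y => ?_⟩
      by_cases hy : y = 0
      · simp [hy]
      have hs : ‖y‖⁻¹ • y ∈ Metric.sphere (0 : Fin d → ℝ) 1 := by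
        simp [norm_smul, hy]
      have := hmin hs
      simp only [Set.mem_ofPred_eq, mulVec_smul, dotProduct_smul, smul_dotProduct, smul_eq_mul]
        at this
      have hp : 0 < ‖y‖ := norm_pos_iff.mpr hy
      calc w ⬝ᵥ Q.mulVec w * ‖y‖ ^ 2 ≤
          (‖y‖⁻¹ * (‖y‖⁻¹ * y ⬝ᵥ Q.mulVec y)) * ‖y‖ ^ 2 := by gcongr
        _ = y ⬝ᵥ Q.mulVec y := by field_simp
  obtain ⟨ε, hε, hb⟩ := key
  have h2 : Filter.Tendsto (fun k => ‖x k‖ ^ 2) Filter.atTop (nhds 0) := by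
    refine squeeze_zero (fun k => by positivity) (fun k => ?_)
      (by simpa using h.const_mul ε⁻¹)
    have := hb (x k)
    rw [← div_eq_inv_mul, le_div_iff₀ hε]
    linarith
  have h3 := h2.sqrt
  simp only [Real.sqrt_sq (norm_nonneg _), Real.sqrt_zero] at h3
  exact tendsto_zero_iff_norm_tendsto_zero.mpr h3

end helpers

/-- **Theorem 1, Variant 1.** Recursive feasibility,
constraint satisfaction and convergence of rollout ETC with cyclic
prediction horizon `N(k) = N̄ - (k mod M)` and time-invariant terminal
ingredients: if the OCP is feasible at time `0`, then along every
closed-loop trajectory in which each applied input is the first element of a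
minimizer of the OCP, the OCP remains feasible at every time, the plant
state and input constraints and the token bucket traffic specification are
fulfilled, and `(x(k), u(k)) → (0, 0)`. -/
theorem rolloutETC_variant1_convergence {n m : ℕ}
    (A : Matrix (Fin n) (Fin n) ℝ) (B : Matrix (Fin n) (Fin m) ℝ)
    (K : Matrix (Fin m) (Fin n ⊕ Fin m) ℝ)
    (g c b M : ℕ) (hg : 1 ≤ g) (hgc : g ≤ c) (hcb : c ≤ b)
    (hM : M = ⌈(c : ℚ) / (g : ℚ)⌉₊)
    (𝕏 : Set (Fin n → ℝ)) (𝕌 : Set (Fin m → ℝ))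
    (hXc : IsClosed 𝕏) (hUc : IsClosed 𝕌)
    (hX0 : (0 : Fin n → ℝ) ∈ 𝕏) (hU0 : (0 : Fin m → ℝ) ∈ 𝕌)
    -- Variant-1 terminal set conditions
    (Z₀ : Set (Fin n ⊕ Fin m → ℝ)) (hZc : IsClosed Z₀)
    (hZ0 : (0 : Fin n ⊕ Fin m → ℝ) ∈ Z₀)
    (hZsub : ∀ z ∈ Z₀, (fun i => z (Sum.inl i)) ∈ 𝕏 ∧ (fun i => z (Sum.inr i)) ∈ 𝕌)
    (hinv1 : ∀ j : ℕ, j + 2 ≤ M → ∀ z ∈ Z₀,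
      (fun i => (((A0mat A B) ^ j * A1mat A B K).mulVec z) (Sum.inl i)) ∈ 𝕏 ∧
      (fun i => (((A0mat A B) ^ j * A1mat A B K).mulVec z) (Sum.inr i)) ∈ 𝕌)
    (hinv2 : ∀ z ∈ Z₀, ((A0mat A B) ^ (M - 1) * A1mat A B K).mulVec z ∈ Z₀)
    (hK : ∀ z ∈ Z₀, K.mulVec z ∈ 𝕌)
    -- cost matrices and Variant-1 terminal cost conditions
    (Q : Matrix (Fin n) (Fin n) ℝ) (R : Matrix (Fin m) (Fin m) ℝ)
    (hQ : Q.PosDef) (hR : R.PosDef)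
    (P₀ : Matrix (Fin n ⊕ Fin m) (Fin n ⊕ Fin m) ℝ) (hP₀ : P₀.PosSemidef)
    (hMI : (-((A1mat A B K)ᵀ * ((A0mat A B) ^ (M - 1))ᵀ * P₀ * (A0mat A B) ^ (M - 1) *
            A1mat A B K
          - P₀ + fromBlocks Q 0 0 0 + Kᵀ * R * K
          + ∑ j ∈ Finset.Icc 1 (M - 1),
              (A1mat A B K)ᵀ * ((A0mat A B) ^ (j - 1))ᵀ * fromBlocks Q 0 0 R *
                (A0mat A B) ^ (j - 1) * A1mat A B K)).PosSemidef)
    -- cyclic prediction horizon with maximum length `Nb ≥ M`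
    (Nb : ℕ) (hNb : M ≤ Nb)
    -- closed loop generated by Algorithm 1
    (ξcl : ℕ → NCSState n m) (πcl : ℕ → NCSInput n m)
    (hcl : ∀ k : ℕ, ξcl (k + 1) = ncsDyn A B g c b (ξcl k) (πcl k))
    -- whenever the OCP at time `k` is feasible, `π(k)` is the first element
    -- of a minimizer of the OCP at time `k`
    (hopt : ∀ k : ℕ,
      (∃ πs : ℕ → NCSInput n m, FeasOCP A B g c b 𝕏 𝕌 (ξcl k) (Nb - k % M)
        {ξ : NCSState n m | vcat ξ.1 ξ.2.1 ∈ Z₀ ∧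
          (c : ℤ) - (g : ℤ) ≤ ξ.2.2 ∧ ξ.2.2 ≤ (b : ℤ)} πs) →
      ∃ πs : ℕ → NCSInput n m,
        FeasOCP A B g c b 𝕏 𝕌 (ξcl k) (Nb - k % M)
          {ξ : NCSState n m | vcat ξ.1 ξ.2.1 ∈ Z₀ ∧
            (c : ℤ) - (g : ℤ) ≤ ξ.2.2 ∧ ξ.2.2 ≤ (b : ℤ)} πs ∧
        (∀ πs' : ℕ → NCSInput n m,
          FeasOCP A B g c b 𝕏 𝕌 (ξcl k) (Nb - k % M)
            {ξ : NCSState n m | vcat ξ.1 ξ.2.1 ∈ Z₀ ∧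
              (c : ℤ) - (g : ℤ) ≤ ξ.2.2 ∧ ξ.2.2 ≤ (b : ℤ)} πs' →
          costGen A B g c b Q R
              (fun ξ => vcat ξ.1 ξ.2.1 ⬝ᵥ P₀.mulVec (vcat ξ.1 ξ.2.1))
              (ξcl k) (Nb - k % M) πs ≤
            costGen A B g c b Q R
              (fun ξ => vcat ξ.1 ξ.2.1 ⬝ᵥ P₀.mulVec (vcat ξ.1 ξ.2.1))
              (ξcl k) (Nb - k % M) πs') ∧
        πcl k = πs 0)
    -- feasibility of the OCP at time `0`
    (hfeas0 : ∃ πs : ℕ → NCSInput n m, FeasOCP A B g c b 𝕏 𝕌 (ξcl 0) (Nb - 0 % M)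
      {ξ : NCSState n m | vcat ξ.1 ξ.2.1 ∈ Z₀ ∧
        (c : ℤ) - (g : ℤ) ≤ ξ.2.2 ∧ ξ.2.2 ≤ (b : ℤ)} πs) :
    -- (i) the OCP is feasible at every time `k`
    (∀ k : ℕ, ∃ πs : ℕ → NCSInput n m, FeasOCP A B g c b 𝕏 𝕌 (ξcl k) (Nb - k % M)
      {ξ : NCSState n m | vcat ξ.1 ξ.2.1 ∈ Z₀ ∧
        (c : ℤ) - (g : ℤ) ≤ ξ.2.2 ∧ ξ.2.2 ≤ (b : ℤ)} πs) ∧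
    -- (ii) state and input constraints and the token bucket TS are fulfilled
    (∀ k : ℕ, (ξcl k).1 ∈ 𝕏 ∧ (ξcl k).2.1 ∈ 𝕌 ∧
      0 ≤ (ξcl k).2.2 ∧ (ξcl k).2.2 ≤ (b : ℤ) ∧ (πcl k).1 ∈ 𝕌) ∧
    -- (iii) `(x(k), u(k)) → (0, 0)` as `k → ∞`
    Filter.Tendsto (fun k => ((ξcl k).1, (ξcl k).2.1)) Filter.atTop
      (nhds (0, 0)) := by
  have hg0 : (0 : ℚ) < g := by exact_mod_cast hg
  have hM1 : 1 ≤ M := by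
    rw [hM, Nat.one_le_ceil_iff]
    have : (0 : ℚ) < c := by exact_mod_cast (by omega : 0 < c)
    positivity
  have hMc : c ≤ M * g := by
    have h := Nat.le_ceil ((c : ℚ) / (g : ℚ))
    rw [← hM, div_le_iff₀ hg0] at h
    exact_mod_cast h
  obtain ⟨L, rfl⟩ : ∃ L, M = L + 1 := ⟨M - 1, by omega⟩
  clear hM
  simp only [Nat.add_sub_cancel] at hinv2 hMI
  set S : Set (NCSState n m) := {ξ : NCSState n m | vcat ξ.1 ξ.2.1 ∈ Z₀ ∧
          (c : ℤ) - (g : ℤ) ≤ ξ.2.2 ∧ ξ.2.2 ≤ (b : ℤ)} with hS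
  set Vf : NCSState n m → ℝ := fun ξ => vcat ξ.1 ξ.2.1 ⬝ᵥ P₀.mulVec (vcat ξ.1 ξ.2.1) with hVf
  -- local feasibility
  have hloc : ∀ ξ ∈ S, FeasOCP A B g c b 𝕏 𝕌 ξ (L + 1) S (locSeq K (vcat ξ.1 ξ.2.1)) := by
    rintro ξ ⟨hz, hβ1, hβ2⟩
    refine ⟨fun i hi => ?_, ?_, ?_⟩
    · cases i with
      | zero =>
        have := hZsub _ hz
        refine ⟨this.1, this.2, ?_, hβ2, ?_⟩
        · have : (0 : ℤ) ≤ c - g := by omega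
          exact this.trans hβ1
        · simpa [locSeq] using hK _ hz
      | succ j =>
        have h1 := hinv1 j (by omega) _ hz
        rw [← loc_vcat A B g c b] at h1
        have h2 := loc_bucket A B g c b hgc K ξ hβ1 j
        refine ⟨h1.1, h1.2, le_trans ?_ h2.1, h2.2, ?_⟩
        · positivity
        · simpa [locSeq] using hU0
    · rw [loc_vcat]
      exact hinv2 _ hz
    · have h2 := loc_bucket A B g c b hgc K ξ hβ1 L
      refine ⟨le_trans ?_ h2.1, h2.2⟩
      have : (c : ℤ) ≤ (L + 1) * g := by exact_mod_cast hMc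
      rw [add_mul, one_mul] at this
      apply le_min <;> omega
  have hstage : ∀ ξ π, 0 ≤ stageCost Q R ξ π := by
    intro ξ π
    have h1 : 0 ≤ ξ.1 ⬝ᵥ Q.mulVec ξ.1 := by
      simpa using hQ.posSemidef.dotProduct_mulVec_nonneg ξ.1
    have h2 : ∀ u, 0 ≤ u ⬝ᵥ R.mulVec u := fun u => by
      simpa using hR.posSemidef.dotProduct_mulVec_nonneg u
    unfold stageCost
    split_ifs
    · exact add_nonneg h1 (h2 _)
    · exact add_nonneg h1 (h2 _)
  have hcost0 : ∀ ξ N πs, 0 ≤ costGen A B g c b Q R Vf ξ N πs := by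
    intro ξ N πs
    refine add_nonneg (Finset.sum_nonneg fun i _ => hstage _ _) ?_
    simpa using hP₀.dotProduct_mulVec_nonneg _
  -- one step
  have hstep : ∀ k πs, FeasOCP A B g c b 𝕏 𝕌 (ξcl k) (Nb - k % (L + 1)) S πs →
      πcl k = πs 0 →
      ∃ πs', FeasOCP A B g c b 𝕏 𝕌 (ξcl (k + 1)) (Nb - (k + 1) % (L + 1)) S πs' ∧
        costGen A B g c b Q R Vf (ξcl (k + 1)) (Nb - (k + 1) % (L + 1)) πs' +
          stageCost Q R (ξcl k) (πcl k) ≤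
        costGen A B g c b Q R Vf (ξcl k) (Nb - k % (L + 1)) πs := by
    intro k πs hf h0
    have hlt : k % (L + 1) < L + 1 := Nat.mod_lt k (Nat.succ_pos L)
    rw [hcl k]
    by_cases hk : k % (L + 1) = L
    · have hk1 : (k + 1) % (L + 1) = 0 := by
        rw [Nat.add_mod, hk]
        rcases L with _ | L
        · simp
        · simp
      have hN1 : Nb - k % (L + 1) + (L + 1) = Nb + 1 := by omega
      have hN2 : Nb - (k + 1) % (L + 1) = Nb := by omega
      rw [hN2]
      have hc := feas_concat A B g c b 𝕏 𝕌 _ _ _ _ _ _ _ hf (hloc _ hf.2)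
      have hv := cost_concat A B g c b Q R Vf (ξcl k) (Nb - k % (L + 1)) (L + 1) πs _
        (loc_cost A B g c b K Q R P₀ L hMI _)
      have hz : ∀ σ, concatSeq (Nb - k % (L + 1)) πs σ 0 = πcl k := by
        intro σ
        simp only [concatSeq]
        rw [if_pos (by omega), h0]
      generalize hσ : locSeq K _ = σ at hc
      rw [hσ] at hv
      rw [hN1] at hc hv
      have hc' := feas_shift A B g c b 𝕏 𝕌 _ _ _ _ hc
      rw [cost_shift] at hv
      rw [hz] at hc' hv
      exact ⟨_, hc', by linarith⟩
    · have hk1 : (k + 1) % (L + 1) = k % (L + 1) + 1 := by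
        rw [Nat.add_mod_eq_ite]
        have : 1 % (L + 1) = 1 := Nat.mod_eq_of_lt (by omega)
        rw [this, if_neg (by omega)]
      have hN : Nb - k % (L + 1) = (Nb - (k + 1) % (L + 1)) + 1 := by omega
      rw [hN] at hf ⊢
      have hc' := feas_shift A B g c b 𝕏 𝕌 _ _ _ _ hf
      refine ⟨_, h0 ▸ hc', ?_⟩
      rw [cost_shift, ← h0]
      linarith
  have hfeas : ∀ k, ∃ πs, FeasOCP A B g c b 𝕏 𝕌 (ξcl k) (Nb - k % (L + 1)) S πs := by
    intro k
    induction k with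
    | zero => exact hfeas0
    | succ k ih =>
      obtain ⟨πs, h1, -, h3⟩ := hopt k ih
      obtain ⟨πs', h, -⟩ := hstep k πs h1 h3
      exact ⟨πs', h⟩
  have hall := fun k => hopt k (hfeas k)
  choose πo ho1 ho2 ho3 using hall
  refine ⟨hfeas, fun k => ?_, ?_⟩
  · have hlt : k % (L + 1) < L + 1 := Nat.mod_lt k (Nat.succ_pos L)
    have := (ho1 k).1 0 (by omega)
    rw [ho3 k]
    simpa only [ncsTraj] using this
  set V : ℕ → ℝ := fun k => costGen A B g c b Q R Vf (ξcl k) (Nb - k % (L + 1)) (πo k) with hV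
  have hdec : ∀ k, V (k + 1) + stageCost Q R (ξcl k) (πcl k) ≤ V k := by
    intro k
    obtain ⟨πs', h1, h2⟩ := hstep k _ (ho1 k) (ho3 k)
    have := ho2 (k + 1) πs' h1
    simp only [hV]
    linarith
  have hsumb : ∀ k, V k + ∑ i ∈ Finset.range k, stageCost Q R (ξcl i) (πcl i) ≤ V 0 := by
    intro k
    induction k with
    | zero => simp
    | succ k ih =>
      rw [Finset.sum_range_succ]
      linarith [hdec k]
  have hsummable : Summable (fun i => stageCost Q R (ξcl i) (πcl i)) :=
    summable_of_sum_range_le (c := V 0) (fun i => hstage _ _) fun k => by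
      have := hcost0 (ξcl k) (Nb - k % (L + 1)) (πo k)
      linarith [hsumb k]
  have ht := hsummable.tendsto_atTop_zero
  have hs : ∀ k, stageCost Q R (ξcl k) (πcl k) = (ξcl k).1 ⬝ᵥ Q.mulVec (ξcl k).1 +
      (ξcl (k + 1)).2.1 ⬝ᵥ R.mulVec (ξcl (k + 1)).2.1 := by
    intro k
    rw [hcl k]
    simp only [stageCost, ncsDyn]
    split_ifs <;> rfl
  have hq : ∀ x, 0 ≤ x ⬝ᵥ Q.mulVec x := fun u => by
    simpa using hQ.posSemidef.dotProduct_mulVec_nonneg u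
  have hr : ∀ u, 0 ≤ u ⬝ᵥ R.mulVec u := fun u => by
    simpa using hR.posSemidef.dotProduct_mulVec_nonneg u
  have hx := posDef_tendsto Q hQ (fun k => (ξcl k).1)
    (squeeze_zero (fun k => hq _) (fun k => by rw [hs k]; linarith [hr (ξcl (k + 1)).2.1]) ht)
  have hu := posDef_tendsto R hR (fun k => (ξcl (k + 1)).2.1)
    (squeeze_zero (fun k => hr _) (fun k => by rw [hs k]; linarith [hq (ξcl k).1]) ht)
  have hu' := (Filter.tendsto_add_atTop_iff_nat (f := fun k => (ξcl k).2.1) 1).mp hu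
  exact hx.prodMk_nhds hu'
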